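/- Let q, p ∈ ℕ ∪ {∞}. Given a finite set S ⊆ Ω_{2q} × Ω_{2p}, there exist an antipodal free set Y ⊆ Ω_{2q} × Ω_{2p} and two finite sets Θ and Δ of angles in [0,2π) such that S is contained in the enhanced set X associated to Y, Θ and Δ. -/

import Mathlib

open scoped ComplexOrder

noncomputable section

/-- The Hilbert space ℓ²(ℂ) of square–summable complex sequences. -/
abbrev Ell2 : Type := lp (fun _ : ℕ => ℂ) 2

/-- The Hermitian inner product of the paper: `hdot z w = z·w = Σ_j z_j conj(w_j)`. -/
def hdot (z w : Ell2) : ℂ := @inner ℂ _ _ w z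

/-- The sphere `Ω_{2q}` (for `q : ℕ∞`), viewed inside ℓ²(ℂ): the unit vectors supported
on the first `q` coordinates; for `q = ⊤` this is the unit sphere `Ω_∞` of ℓ²(ℂ). -/
def Omega (q : ℕ∞) : Set Ell2 :=
  {z | ‖z‖ = 1 ∧ ∀ j : ℕ, q ≤ (j : ℕ∞) → z j = 0}

/-- A kernel `K` is positive definite on a set `S`. -/
def IsPDKernel {α : Type*} (S : Set α) (K : α → α → ℂ) : Prop :=
  ∀ (L : ℕ) (x : Fin L → α), (∀ i, x i ∈ S) → Function.Injective x →
    ∀ c : Fin L → ℂ, 0 ≤ ∑ μ, ∑ ν, c μ * (starRingEnd ℂ) (c ν) * K (x μ) (x ν)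

/-- A kernel `K` is strictly positive definite on a set `S`. -/
def IsSPDKernel {α : Type*} (S : Set α) (K : α → α → ℂ) : Prop :=
  IsPDKernel S K ∧
    ∀ (L : ℕ) (x : Fin L → α), (∀ i, x i ∈ S) → Function.Injective x →
      ∀ c : Fin L → ℂ,
        ∑ μ, ∑ ν, c μ * (starRingEnd ℂ) (c ν) * K (x μ) (x ν) = 0 → c = 0

/-- `f` is positive definite on `Ω_{2q} × Ω_{2p}`. -/
def PDonProd (q p : ℕ∞) (f : ℂ → ℂ → ℂ) : Prop :=
  IsPDKernel ((Omega q) ×ˢ (Omega p))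
    (fun x y => f (hdot x.1 y.1) (hdot x.2 y.2))

/-- `f` is strictly positive definite on `Ω_{2q} × Ω_{2p}`. -/
def SPDonProd (q p : ℕ∞) (f : ℂ → ℂ → ℂ) : Prop :=
  IsSPDKernel ((Omega q) ×ˢ (Omega p))
    (fun x y => f (hdot x.1 y.1) (hdot x.2 y.2))

/-- `g` is positive definite on `Ω_{2q}`. -/
def PDonSphere (q : ℕ∞) (g : ℂ → ℂ) : Prop :=
  IsPDKernel (Omega q) (fun z z' => g (hdot z z'))

/-- The Jacobi polynomial of degree `k` with (integer) parameters `α, β`, normalized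
so that its value at `1` is `1`. -/
def jacobiR (α β k : ℕ) (x : ℝ) : ℝ :=
  (∑ s ∈ Finset.range (k + 1),
      ((k + α).choose (k - s) : ℝ) * ((k + β).choose s : ℝ) *
        ((x - 1) / 2) ^ s * ((x + 1) / 2) ^ (k - s)) /
    ((k + α).choose k : ℝ)

/-- The disc polynomial `R_{m,n}^{q-2}`; for `q = ⊤` (and also `q = 1`) it is
`ξ^m conj(ξ)^n`.  For `2 ≤ q < ⊤` it equals
`r^{|m-n|} e^{i(m-n)φ} R_{min(m,n)}^{(q-2,|m-n|)}(2r²-1)` for `ξ = r e^{iφ}`. -/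
def discR (q : ℕ∞) (m n : ℕ) (ξ : ℂ) : ℂ :=
  if q = ⊤ ∨ q ≤ 1 then ξ ^ m * (starRingEnd ℂ ξ) ^ n
  else (if n ≤ m then ξ ^ (m - n) else (starRingEnd ℂ ξ) ^ (n - m)) *
    ((jacobiR (q.toNat - 2) (max m n - min m n) (min m n)
        (2 * ‖ξ‖ ^ 2 - 1) : ℝ) : ℂ)

/-- The natural domain `𝔻̃`: the unit circle `∂𝔻` when `q = 1` (the sphere `Ω₂`),
the closed unit disc `𝔻` otherwise. -/
def domD (q : ℕ∞) : Set ℂ :=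
  if q = 1 then Metric.sphere (0 : ℂ) 1 else Metric.closedBall (0 : ℂ) 1

/-- `A ⊆ ℤ²` intersects every product of full arithmetic progressions in ℤ. -/
def MeetsAllProgressions (A : Set (ℤ × ℤ)) : Prop :=
  ∀ N M x y : ℤ, 0 < N → 0 < M → 0 < x → 0 < y →
    ∃ v ∈ A, (∃ j : ℤ, v.1 = N * j + x) ∧ (∃ j : ℤ, v.2 = M * j + y)

/-- A set of points of `Ω_{2q} × Ω_{2p}` is antipodal free: for distinct points,
`|z·z'| < 1` unless `z = z'`, and `|w·w'| < 1` unless `w = w'`. -/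
def AntipodalFree (Y : Set (Ell2 × Ell2)) : Prop :=
  ∀ y ∈ Y, ∀ y' ∈ Y, y ≠ y' →
    (y.1 = y'.1 ∨ ‖hdot y.1 y'.1‖ < 1) ∧
    (y.2 = y'.2 ∨ ‖hdot y.2 y'.2‖ < 1)

/-- The enhanced set associated to `Y`, `Θ` and `Δ`:
`X = {(e^{iθ} z, e^{iδ} w) : (z,w) ∈ Y, θ ∈ Θ, δ ∈ Δ}`. -/
def enhancedSet (Y : Set (Ell2 × Ell2)) (Θ Δ : Set ℝ) : Set (Ell2 × Ell2) :=
  {x | ∃ y ∈ Y, ∃ θ ∈ Θ, ∃ δ ∈ Δ,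
    x = (Complex.exp ((θ : ℂ) * Complex.I) • y.1,
         Complex.exp ((δ : ℂ) * Complex.I) • y.2)}

/-- A chosen representative of the orbit of `z` under multiplication by unimodular scalars. -/
def phaseRep (z : Ell2) : Ell2 :=
  (Quotient.mk (MulAction.orbitRel Circle Ell2) z).out

theorem phaseRep_mem_orbit (z : Ell2) : phaseRep z ∈ MulAction.orbit Circle z :=
  MulAction.orbitRel_apply.1 (Quotient.mk_out (s := MulAction.orbitRel Circle Ell2) z)

theorem phaseRep_eq_of_mem_orbit {z z' : Ell2} (h : z ∈ MulAction.orbit Circle z') :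
    phaseRep z = phaseRep z' :=
  congrArg Quotient.out (Quotient.sound (s := MulAction.orbitRel Circle Ell2) h)

theorem phaseRep_mem_Omega {q : ℕ∞} {z : Ell2} (hz : z ∈ Omega q) : phaseRep z ∈ Omega q := by
  obtain ⟨c, hc⟩ := phaseRep_mem_orbit z
  have hc' : (c : ℂ) • z = phaseRep z := hc
  rw [← hc']
  refine ⟨by rw [norm_smul, Circle.norm_coe, hz.1, one_mul], fun j hj => ?_⟩
  rw [lp.coeFn_smul, Pi.smul_apply, hz.2 j hj, smul_zero]

theorem Circle.exists_angle_mem_Ico (c : Circle) :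
    ∃ θ ∈ Set.Ico 0 (2 * Real.pi), Complex.exp ((θ : ℂ) * Complex.I) = c := by
  obtain ⟨θ, hθ⟩ := Circle.exp_surjective c
  refine ⟨toIcoMod Real.two_pi_pos 0 θ, by simpa using toIcoMod_mem_Ico Real.two_pi_pos 0 θ, ?_⟩
  rw [← Circle.coe_exp, ← hθ, ← self_sub_toIcoDiv_zsmul, Circle.periodic_exp.sub_zsmul_eq]

theorem exists_angle_smul_phaseRep (z : Ell2) :
    ∃ θ ∈ Set.Ico 0 (2 * Real.pi), z = Complex.exp ((θ : ℂ) * Complex.I) • phaseRep z := by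
  obtain ⟨c, hc⟩ := MulAction.mem_orbit_symm.1 (phaseRep_mem_orbit z)
  obtain ⟨θ, hθ, he⟩ := Circle.exists_angle_mem_Ico c
  exact ⟨θ, hθ, by rw [he]; exact hc.symm⟩

/-- Unit vectors whose inner product has modulus at least one differ by a unimodular scalar. -/
theorem mem_orbit_of_one_le_norm_hdot {z z' : Ell2} (hz : ‖z‖ = 1) (hz' : ‖z'‖ = 1)
    (h : 1 ≤ ‖hdot z z'‖) : z ∈ MulAction.orbit Circle z' := by
  have hle : ‖hdot z z'‖ ≤ ‖z'‖ * ‖z‖ := norm_inner_le_norm z' z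
  have heq : ‖hdot z z'‖ = ‖z'‖ * ‖z‖ := le_antisymm hle (by rw [hz, hz', one_mul]; exact h)
  obtain ⟨r, -, hr⟩ := (norm_inner_eq_norm_iff (𝕜 := ℂ)
    (norm_ne_zero_iff.1 (by rw [hz']; exact one_ne_zero))
    (norm_ne_zero_iff.1 (by rw [hz]; exact one_ne_zero))).1 heq
  have hr1 : ‖r‖ = 1 := by rw [hr, norm_smul, hz', mul_one] at hz; exact hz
  exact ⟨⟨r, mem_sphere_zero_iff_norm.2 hr1⟩, hr.symm⟩

theorem phaseRep_eq_or_norm_hdot_lt_one {q : ℕ∞} {z z' : Ell2} (hz : z ∈ Omega q)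
    (hz' : z' ∈ Omega q) :
    phaseRep z = phaseRep z' ∨ ‖hdot (phaseRep z) (phaseRep z')‖ < 1 := by
  refine or_iff_not_imp_right.2 fun h => phaseRep_eq_of_mem_orbit ?_
  have hrep := mem_orbit_of_one_le_norm_hdot (phaseRep_mem_Omega hz).1
    (phaseRep_mem_Omega hz').1 (not_lt.1 h)
  rw [← MulAction.orbit_eq_iff] at hrep ⊢
  rw [← MulAction.orbit_eq_iff.2 (phaseRep_mem_orbit z), hrep,
    MulAction.orbit_eq_iff.2 (phaseRep_mem_orbit z')]

/-- Lemma 3.5 / `lm_SsubEnh`: every finite subset of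
`Ω_{2q} × Ω_{2p}` is contained in the enhanced set associated to some antipodal free
set `Y` and some finite sets of angles `Θ, Δ ⊆ [0, 2π)`. -/
theorem stmt11 (q p : ℕ∞) (hq : 1 ≤ q) (hp : 1 ≤ p)
    (S : Set (Ell2 × Ell2)) (hSfin : S.Finite) (hS : S ⊆ (Omega q) ×ˢ (Omega p)) :
    ∃ (Y : Set (Ell2 × Ell2)) (Θ Δ : Set ℝ),
      Y.Finite ∧ Y ⊆ (Omega q) ×ˢ (Omega p) ∧ AntipodalFree Y ∧
      Θ.Finite ∧ Θ ⊆ Set.Ico 0 (2 * Real.pi) ∧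
      Δ.Finite ∧ Δ ⊆ Set.Ico 0 (2 * Real.pi) ∧
      S ⊆ enhancedSet Y Θ Δ := by
  choose angle hangle hrep using exists_angle_smul_phaseRep
  refine ⟨Prod.map phaseRep phaseRep '' S, (fun x => angle x.1) '' S, (fun x => angle x.2) '' S,
    hSfin.image _, ?_, ?_, hSfin.image _, ?_, hSfin.image _, ?_, ?_⟩
  · rintro _ ⟨x, hx, rfl⟩
    exact ⟨phaseRep_mem_Omega (hS hx).1, phaseRep_mem_Omega (hS hx).2⟩
  · rintro _ ⟨x, hx, rfl⟩ _ ⟨x', hx', rfl⟩ -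
    exact ⟨phaseRep_eq_or_norm_hdot_lt_one (hS hx).1 (hS hx').1,
      phaseRep_eq_or_norm_hdot_lt_one (hS hx).2 (hS hx').2⟩
  · rintro _ ⟨x, -, rfl⟩
    exact hangle x.1
  · rintro _ ⟨x, -, rfl⟩
    exact hangle x.2
  · intro x hx
    exact ⟨_, ⟨x, hx, rfl⟩, _, ⟨x, hx, rfl⟩, _, ⟨x, hx, rfl⟩, Prod.ext (hrep x.1) (hrep x.2)⟩

end
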